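/- Fix real parameters κ,λ, a step size s>0, and 0<q<1. Write c(x,z;κ',λ',υ',ς';q',s') for the normalized c-function with Hecke parameters (κ',λ',υ',ς'), deformation parameter q' and step size s'. Let x,z∈ℂ be such that all the c-function values below are defined and the denominators below are nonzero. Then the following two identities hold: (1) c(x,−z;κ,λ,κ,λ;q,s)/c(z,−x;κ,κ,λ,λ;q,s) = c(x,−z/2;κ,λ,0,0;q,s/2)/c(z/2,−x;κ,0,λ,0;q,s/2); (2) (c(x,z;κ,λ,κ,λ;q,s) − c(z,x;κ,κ,λ,λ;q,s))/c(z,−x;κ,κ,λ,λ;q,s) = (c(x,z/2;κ,λ,0,0;q,s/2) − c(z/2,x;κ,0,λ,0;q,s/2))/c(z/2,−x;κ,0,λ,0;q,s/2). Moreover, the common value in (1) equals q^{−4κx/s}·q^{2(κ+λ)z/s}·θ(q^{2x}, q^{s/2+2λ+z}, q^{2κ+z}; q^s)/θ(q^z, q^{κ+λ+x}, −q^{κ−λ+x}; q^{s/2}). -/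

import Mathlib

noncomputable section

/-- `qc q x = q^x := exp(x·log q)` for a real base `q` and complex exponent `x`. -/
def qc (q : ℝ) (x : ℂ) : ℂ := Complex.exp (x * Complex.log (q : ℂ))

/-- Finite q-shifted factorial `(a;p)_n`. -/
def qPoch (a p : ℂ) (n : ℕ) : ℂ := ∏ i ∈ Finset.range n, (1 - a * p ^ i)

/-- Infinite q-shifted factorial `(a;p)_∞`. -/
def qPochInf (a p : ℂ) : ℂ := ∏' i : ℕ, (1 - a * p ^ i)

/-- Very-well-poised basic hypergeometric series `₈W₇(a₀;a₁,…,a₅;p,u)`. -/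
def W8 (a0 a1 a2 a3 a4 a5 p u : ℂ) : ℂ :=
  ∑' r : ℕ, ((1 - a0 * p ^ (2 * r)) / (1 - a0)) * u ^ r *
    ((qPoch a0 p r * qPoch a1 p r * qPoch a2 p r * qPoch a3 p r * qPoch a4 p r *
        qPoch a5 p r) /
      (qPoch (p * a0 / a0) p r * qPoch (p * a0 / a1) p r * qPoch (p * a0 / a2) p r *
        qPoch (p * a0 / a3) p r * qPoch (p * a0 / a4) p r * qPoch (p * a0 / a5) p r))

/-- All the "denominator" factors of the `₈W₇` series are nonzero. -/
def W8Denom (a0 a1 a2 a3 a4 a5 p : ℂ) : Prop :=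
  1 - a0 ≠ 0 ∧ ∀ r : ℕ,
    qPoch (p * a0 / a0) p r ≠ 0 ∧ qPoch (p * a0 / a1) p r ≠ 0 ∧
    qPoch (p * a0 / a2) p r ≠ 0 ∧ qPoch (p * a0 / a3) p r ≠ 0 ∧
    qPoch (p * a0 / a4) p r ≠ 0 ∧ qPoch (p * a0 / a5) p r ≠ 0

/-- Basic hypergeometric series `₄φ₃(a₁,a₂,a₃,a₄;b₁,b₂,b₃;p,u)`. -/
def phi43 (a1 a2 a3 a4 b1 b2 b3 p u : ℂ) : ℂ :=
  ∑' j : ℕ, (qPoch a1 p j * qPoch a2 p j * qPoch a3 p j * qPoch a4 p j) * u ^ j /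
    (qPoch p p j * qPoch b1 p j * qPoch b2 p j * qPoch b3 p j)

/-- Modified Jacobi theta function `θ(u;p)`. -/
def theta (u p : ℂ) : ℂ := qPochInf u p * qPochInf (p / u) p

/-- Askey–Wilson parameter `a_s = q^{κ+λ}`. -/
def aP (q : ℝ) (k lm : ℝ) : ℂ := qc q (k + lm)

/-- Askey–Wilson parameter `b_s = -q^{κ-λ}`. -/
def bP (q : ℝ) (k lm : ℝ) : ℂ := -qc q (k - lm)

/-- Askey–Wilson parameter `c_s = q^{s/2+υ+ς}`. -/
def cP (q : ℝ) (s up sg : ℝ) : ℂ := qc q (s / 2 + up + sg)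

/-- Askey–Wilson parameter `d_s = -q^{s/2+υ-ς}`. -/
def dP (q : ℝ) (s up sg : ℝ) : ℂ := -qc q (s / 2 + up - sg)

/-- The weight `W(x,z) = q^{(κ+λ+x)(κ+υ+z)/s}`. -/
def Wgt (q s k lm up : ℝ) (x z : ℂ) : ℂ := qc q ((k + lm + x) * (k + up + z) / s)

/-- The singular term `St(x)`; dual version is obtained by swapping `lm` and `up`. -/
def St (q s k lm up sg : ℝ) (x : ℂ) : ℂ :=
  qPochInf (qc q (s + x) / aP q k lm) (qc q s) * qPochInf (qc q (s + x) / bP q k lm) (qc q s) *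
  qPochInf (qc q (s + x) / cP q s up sg) (qc q s) *
  qPochInf (qc q (s + x) / dP q s up sg) (qc q s)

/-- The series part `Ψ(x,z)` of the asymptotically free eigenfunction. -/
def Psi (q s k lm up sg : ℝ) (x z : ℂ) : ℂ :=
  (qPochInf (qc q (s + x + z) * aP q k lm / aP q k up) (qc q s) *
   qPochInf (qc q (s + x + z) * bP q k lm / aP q k up) (qc q s) *
   qPochInf (qc q (s + x + z) * cP q s up sg / aP q k up) (qc q s) *
   qPochInf (qc q (s + x + z) * aP q k up / dP q s up sg) (qc q s) *
   qPochInf (qc q (s + 2 * z)) (qc q s) *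
   qPochInf (dP q s up sg * qc q x) (qc q s) /
   qPochInf (qc q (2 * s + x + 2 * z) / dP q s up sg) (qc q s)) *
  W8 (qc q (s + x + 2 * z) / dP q s up sg) (qc q (s + z) / aP q k up)
     (qc q (s + z) / dP q s lm sg) (bP q k up * qc q z) (cP q s lm sg * qc q z)
     (qc q (s + x) / dP q s up sg) (qc q s) (dP q s up sg * qc q x)

/-- The asymptotically free eigenfunction `Φ(x,z;κ,λ,υ,ς;q,s)`. -/
def Phi (q s k lm up sg : ℝ) (x z : ℂ) : ℂ :=
  Wgt q s k lm up x z * Psi q s k lm up sg x z /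
    (St q s k lm up sg x * St q s k up lm sg z)

/-- The Askey–Wilson function `E(x,z;κ,λ,υ,ς;q,s)`. -/
def AWE (q s k lm up sg : ℝ) (x z : ℂ) : ℂ :=
  (qPochInf (aP q k up * qc q (s + z - x) / dP q s up sg) (qc q s) *
   qPochInf (aP q k up * qc q (s + z + x) / dP q s up sg) (qc q s) *
   qPochInf (aP q k lm * bP q k lm) (qc q s) *
   qPochInf (aP q k lm * cP q s up sg) (qc q s) *
   qPochInf (qc q s * aP q k lm / dP q s up sg) (qc q s)) /
  (qPochInf (qc q (s + x) / dP q s up sg) (qc q s) *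
   qPochInf (qc q (s - x) / dP q s up sg) (qc q s) *
   qPochInf (qc q (s + z) / dP q s lm sg) (qc q s) *
   qPochInf (aP q k up * bP q k up * cP q s lm sg * qc q z) (qc q s)) *
  W8 (aP q k up * bP q k up * cP q s lm sg * qc q (-s + z))
     (aP q k lm * qc q x) (aP q k lm * qc q (-x)) (aP q k up * qc q z)
     (bP q k up * qc q z) (cP q s lm sg * qc q z) (qc q s) (qc q (s - z) / dP q s lm sg)

/-- The normalized `c`-function; the dual version swaps `lm` and `up`. -/
def cF (q s k lm up sg : ℝ) (x z : ℂ) : ℂ :=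
  (theta (aP q k up * qc q (-z)) (qc q s) * theta (bP q k up * qc q (-z)) (qc q s) *
   theta (cP q s lm sg * qc q (-z)) (qc q s) *
   theta (dP q s up sg * qc q (x - z) / aP q k up) (qc q s)) /
  (Wgt q s k lm up x z *
    (theta (qc q (-(2 * z))) (qc q s) * theta (dP q s up sg * qc q x) (qc q s)))

/-- The coefficient `A(x)` of the Askey–Wilson difference operator. -/
def AOp (q s k lm up sg : ℝ) (x : ℂ) : ℂ :=
  ((1 - aP q k lm * qc q x) * (1 - bP q k lm * qc q x) * (1 - cP q s up sg * qc q x) *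
    (1 - dP q s up sg * qc q x)) /
  (aP q k up * (1 - qc q (2 * x)) * (1 - qc q (s + 2 * x)))


/-- The c-function value `c(x,z;κ,λ,υ,ς;q,s)` is defined: its theta denominator
is nonzero. -/
def cDef (q s k lm up sg : ℝ) (x z : ℂ) : Prop :=
  theta (qc q (-(2 * z))) (qc q s) * theta (dP q s up sg * qc q x) (qc q s) ≠ 0

section ThetaFunctions

open Filter Topology

theorem summable_mul_pow_of_norm_lt_one (a : ℂ) {p : ℂ} (hp : ‖p‖ < 1) :
    Summable fun i : ℕ => ‖-(a * p ^ i)‖ := by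
  simpa [norm_mul, norm_pow] using
    (summable_geometric_of_lt_one (norm_nonneg p) hp).mul_left ‖a‖

theorem multipliable_qPochInf (a : ℂ) {p : ℂ} (hp : ‖p‖ < 1) :
    Multipliable fun i : ℕ => 1 - a * p ^ i := by
  simpa [sub_eq_add_neg] using
    multipliable_one_add_of_summable (summable_mul_pow_of_norm_lt_one a hp)

theorem tendsto_qPoch (a : ℂ) {p : ℂ} (hp : ‖p‖ < 1) :
    Tendsto (qPoch a p) atTop (𝓝 (qPochInf a p)) :=
  (multipliable_qPochInf a hp).hasProd.tendsto_prod_nat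

theorem one_sub_mul_pow_ne_zero {p : ℂ} (hp : ‖p‖ < 1) (i : ℕ) : 1 - p * p ^ i ≠ 0 := by
  intro h
  have h1 : p ^ (i + 1) = 1 := by rw [pow_succ']; exact (sub_eq_zero.mp h).symm
  have h2 : ‖p‖ ^ (i + 1) = 1 := by rw [← norm_pow, h1, norm_one]
  exact (pow_lt_one₀ (norm_nonneg p) hp (Nat.succ_ne_zero i)).ne h2

theorem qPoch_self_ne_zero {p : ℂ} (hp : ‖p‖ < 1) (n : ℕ) : qPoch p p n ≠ 0 :=
  Finset.prod_ne_zero_iff.mpr fun i _ => one_sub_mul_pow_ne_zero hp i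

theorem qPochInf_self_ne_zero {p : ℂ} (hp : ‖p‖ < 1) : qPochInf p p ≠ 0 := by
  have := tprod_one_add_ne_zero_of_summable (f := fun i : ℕ => -(p * p ^ i))
    (fun i => by simpa [sub_eq_add_neg] using one_sub_mul_pow_ne_zero hp i)
    (summable_mul_pow_of_norm_lt_one p hp)
  simpa [qPochInf, sub_eq_add_neg] using this

/-- `1/(p;p)_m`, extended by zero to negative integers `m`. -/
def qFactInv (p : ℂ) (m : ℤ) : ℂ := if 0 ≤ m then (qPoch p p m.toNat)⁻¹ else 0

theorem qFactInv_sub_one {p : ℂ} (hp : ‖p‖ < 1) (m : ℤ) :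
    qFactInv p (m - 1) = (1 - p ^ m) * qFactInv p m := by
  unfold qFactInv
  rcases lt_trichotomy m 0 with h | rfl | h
  · rw [if_neg (by omega), if_neg (by omega), mul_zero]
  · simp
  · obtain ⟨n, rfl⟩ : ∃ n : ℕ, m = n + 1 := ⟨(m - 1).toNat, by omega⟩
    have h1 : ((n : ℤ) + 1 - 1).toNat = n := by omega
    have h2 : ((n : ℤ) + 1).toNat = n + 1 := by omega
    have h3 : p ^ ((n : ℤ) + 1) = p * p ^ n := by
      rw [show (n : ℤ) + 1 = ((n + 1 : ℕ) : ℤ) by push_cast; rfl, zpow_natCast, pow_succ']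
    rw [if_pos (by omega), if_pos (by omega), h1, h2, h3]
    have h4 := qPoch_self_ne_zero hp n
    have h5 := one_sub_mul_pow_ne_zero hp n
    have h6 : qPoch p p (n + 1) = qPoch p p n * (1 - p * p ^ n) := Finset.prod_range_succ _ _
    rw [h6]
    field_simp

theorem tendsto_qFactInv {p : ℂ} (hp : ‖p‖ < 1) {f : ℕ → ℤ} (hf : Tendsto f atTop atTop) :
    Tendsto (fun n => qFactInv p (f n)) atTop (𝓝 (qPochInf p p)⁻¹) := by
  have h1 : Tendsto (fun n => (f n).toNat) atTop atTop := by
    refine tendsto_atTop.mpr fun b => ?_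
    filter_upwards [hf.eventually_ge_atTop (b : ℤ)] with n hn
    omega
  refine (((tendsto_qPoch p hp).comp h1).inv₀ (qPochInf_self_ne_zero hp)).congr' ?_
  filter_upwards [hf.eventually_ge_atTop 0] with n hn
  simp [qFactInv, hn]

theorem exists_norm_qFactInv_le {p : ℂ} (hp : ‖p‖ < 1) : ∃ M : ℝ, ∀ m, ‖qFactInv p m‖ ≤ M := by
  obtain ⟨M, hM⟩ := (((tendsto_qPoch p hp).inv₀ (qPochInf_self_ne_zero hp)).norm).bddAbove_range
  refine ⟨M, fun m => ?_⟩
  have h0 : ∀ n, ‖(qPoch p p n)⁻¹‖ ≤ M := fun n => hM ⟨n, rfl⟩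
  unfold qFactInv
  split_ifs
  · exact h0 _
  · simpa using (norm_nonneg _).trans (h0 0)

theorem exists_norm_qPoch_le {p : ℂ} (hp : ‖p‖ < 1) : ∃ M : ℝ, ∀ n, ‖qPoch p p n‖ ≤ M := by
  obtain ⟨M, hM⟩ := (tendsto_qPoch p hp).norm.bddAbove_range
  exact ⟨M, fun n => hM ⟨n, rfl⟩⟩

/-- The bilateral series `∑ r^{k²} v^k`. -/
def thetaSeries (r v : ℂ) : ℂ := ∑' k : ℤ, r ^ (k * k) * v ^ k

theorem summable_norm_nat_thetaSeries {r v : ℂ} (hr : ‖r‖ < 1) (hr0 : r ≠ 0) (hv : v ≠ 0) :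
    Summable fun n : ℕ => ‖r ^ (n * n) * v ^ n‖ := by
  refine summable_of_ratio_test_tendsto_lt_one (l := 0) one_pos
    (Eventually.of_forall fun n => by simp [hr0, hv]) ?_
  have h : Tendsto (fun n : ℕ => (‖r‖ ^ n) * (‖r‖ ^ n) * (‖r‖ * ‖v‖)) atTop (𝓝 0) := by
    have := tendsto_pow_atTop_nhds_zero_of_lt_one (norm_nonneg r) hr
    simpa using (this.mul this).mul_const (‖r‖ * ‖v‖)
  refine h.congr fun n => ?_
  have h1 : ‖r‖ ≠ 0 := norm_ne_zero_iff.mpr hr0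
  have h2 : ‖v‖ ≠ 0 := norm_ne_zero_iff.mpr hv
  simp only [norm_mul, norm_pow, norm_norm]
  field_simp
  ring

theorem summable_norm_thetaSeries {r v : ℂ} (hr : ‖r‖ < 1) (hr0 : r ≠ 0) (hv : v ≠ 0) :
    Summable fun k : ℤ => ‖r ^ (k * k) * v ^ k‖ := by
  refine Summable.of_nat_of_neg ?_ ?_
  · refine (summable_norm_nat_thetaSeries hr hr0 hv).congr fun n => ?_
    rw [← Nat.cast_mul, zpow_natCast, zpow_natCast]
  · refine (summable_norm_nat_thetaSeries hr hr0 (inv_ne_zero hv)).congr fun n => ?_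
    rw [neg_mul_neg, ← Nat.cast_mul, zpow_natCast, zpow_neg, zpow_natCast, inv_pow]

theorem hasSum_thetaSeries {r v : ℂ} (hr : ‖r‖ < 1) (hr0 : r ≠ 0) (hv : v ≠ 0) :
    HasSum (fun k : ℤ => r ^ (k * k) * v ^ k) (thetaSeries r v) :=
  (summable_norm_thetaSeries hr hr0 hv).of_norm.hasSum

theorem norm_sq_lt_one {r : ℂ} (hr : ‖r‖ < 1) : ‖r ^ 2‖ < 1 := by
  rw [norm_pow]; exact pow_lt_one₀ (norm_nonneg r) hr two_ne_zero

/-- The finite form of the Jacobi triple product identity. -/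
theorem hasSum_finite_triple_product {r u : ℂ} (hr : ‖r‖ < 1) (hr0 : r ≠ 0) (hu : u ≠ 0) (n : ℕ) :
    HasSum (fun k : ℤ => qPoch (r ^ 2) (r ^ 2) (2 * n) * qFactInv (r ^ 2) (n + k) *
        qFactInv (r ^ 2) (n - k) * (r ^ (k * k) * (-u / r) ^ k))
      (qPoch u (r ^ 2) n * qPoch (r ^ 2 / u) (r ^ 2) n) := by
  have hp := norm_sq_lt_one hr
  have hp0 : r ^ 2 ≠ 0 := pow_ne_zero 2 hr0
  have hv : -u / r ≠ 0 := div_ne_zero (neg_ne_zero.mpr hu) hr0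
  induction n with
  | zero =>
    convert hasSum_ite_eq (0 : ℤ) (1 : ℂ) using 2 with k
    · split_ifs with hk
      · subst hk; simp [qPoch, qFactInv]
      · rcases lt_or_gt_of_ne hk with h | h
        · have : qFactInv (r ^ 2) (((0 : ℕ) : ℤ) + k) = 0 := if_neg (by simpa using h)
          rw [this]; ring
        · have : qFactInv (r ^ 2) (((0 : ℕ) : ℤ) - k) = 0 := if_neg (by simpa using h)
          rw [this]; ring
    · simp [qPoch]
  | succ n ih =>
    have h0 := ih.mul_left (1 + (r ^ 2) ^ (2 * n + 1))
    have h1 := ((Equiv.subRight (1 : ℤ)).hasSum_iff.mpr ih).mul_left (-(u * (r ^ 2) ^ n))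
    have h2 := ((Equiv.addRight (1 : ℤ)).hasSum_iff.mpr ih).mul_left
      (-(r ^ 2 / u * (r ^ 2) ^ n))
    have hval : qPoch u (r ^ 2) (n + 1) * qPoch (r ^ 2 / u) (r ^ 2) (n + 1) =
        (1 + (r ^ 2) ^ (2 * n + 1)) * (qPoch u (r ^ 2) n * qPoch (r ^ 2 / u) (r ^ 2) n) +
          -(u * (r ^ 2) ^ n) * (qPoch u (r ^ 2) n * qPoch (r ^ 2 / u) (r ^ 2) n) +
          -(r ^ 2 / u * (r ^ 2) ^ n) * (qPoch u (r ^ 2) n * qPoch (r ^ 2 / u) (r ^ 2) n) := by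
      have q1 : qPoch u (r ^ 2) (n + 1) = qPoch u (r ^ 2) n * (1 - u * (r ^ 2) ^ n) :=
        Finset.prod_range_succ _ _
      have q2 : qPoch (r ^ 2 / u) (r ^ 2) (n + 1) =
          qPoch (r ^ 2 / u) (r ^ 2) n * (1 - r ^ 2 / u * (r ^ 2) ^ n) :=
        Finset.prod_range_succ _ _
      rw [q1, q2]
      field_simp
      ring
    rw [hval]
    refine ((h0.add h1).add h2).congr_fun fun k => ?_
    simp only [Function.comp, Equiv.subRight_apply, Equiv.coe_addRight]
    have e1 : qFactInv (r ^ 2) ((n : ℤ) + k) =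
        (1 - (r ^ 2) ^ ((n : ℤ) + 1 + k)) * qFactInv (r ^ 2) ((n : ℤ) + 1 + k) := by
      rw [← qFactInv_sub_one hp]; congr 1; ring
    have e2 : qFactInv (r ^ 2) ((n : ℤ) - k) =
        (1 - (r ^ 2) ^ ((n : ℤ) + 1 - k)) * qFactInv (r ^ 2) ((n : ℤ) + 1 - k) := by
      rw [← qFactInv_sub_one hp]; congr 1; ring
    have e3 : qFactInv (r ^ 2) ((n : ℤ) + (k - 1)) =
        (1 - (r ^ 2) ^ ((n : ℤ) + k)) * qFactInv (r ^ 2) ((n : ℤ) + k) := by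
      rw [← qFactInv_sub_one hp]; congr 1; ring
    have e4 : qFactInv (r ^ 2) ((n : ℤ) - (k + 1)) =
        (1 - (r ^ 2) ^ ((n : ℤ) - k)) * qFactInv (r ^ 2) ((n : ℤ) - k) := by
      rw [← qFactInv_sub_one hp]; congr 1; ring
    have e5 : qPoch (r ^ 2) (r ^ 2) (2 * (n + 1)) = qPoch (r ^ 2) (r ^ 2) (2 * n) *
        (1 - r ^ 2 * (r ^ 2) ^ (2 * n)) * (1 - r ^ 2 * (r ^ 2) ^ (2 * n + 1)) := by
      rw [show 2 * (n + 1) = 2 * n + 1 + 1 by ring]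
      simp only [qPoch, Finset.prod_range_succ]
    rw [show (n : ℤ) - (k - 1) = n + 1 - k by ring, show (n : ℤ) + (k + 1) = n + 1 + k by ring,
      e3, e4, e1, e2, e5]
    push_cast
    have f1 : r ^ ((k - 1) * (k - 1)) = r ^ (k * k) * r / (r ^ k * r ^ k) := by
      rw [show (k - 1) * (k - 1) = k * k + 1 - (k + k) by ring, zpow_sub₀ hr0, zpow_add₀ hr0,
        zpow_add₀ hr0, zpow_one]
    have f2 : r ^ ((k + 1) * (k + 1)) = r ^ (k * k) * r * (r ^ k * r ^ k) := by
      rw [show (k + 1) * (k + 1) = k * k + 1 + (k + k) by ring, zpow_add₀ hr0, zpow_add₀ hr0,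
        zpow_add₀ hr0, zpow_one]
    have g : ∀ m : ℤ, (r ^ 2) ^ m = r ^ m * r ^ m := fun m => by rw [pow_two, mul_zpow]
    rw [f1, f2, zpow_sub_one₀ hv, zpow_add_one₀ hv]
    simp only [g, zpow_add₀ hr0, zpow_sub₀ hr0, zpow_one, zpow_natCast]
    have hk : r ^ k ≠ 0 := zpow_ne_zero k hr0
    generalize r ^ k = R at *
    generalize r ^ (k * k) = S at *
    generalize (-u / r) ^ k = V at *
    generalize qFactInv (r ^ 2) ((n : ℤ) + 1 + k) = G1 at *
    generalize qFactInv (r ^ 2) ((n : ℤ) + 1 - k) = G2 at *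
    generalize qPoch (r ^ 2) (r ^ 2) (2 * n) = G3 at *
    field_simp
    ring

/-- The Jacobi triple product identity. -/
theorem theta_sq_eq_thetaSeries {r u : ℂ} (hr : ‖r‖ < 1) (hr0 : r ≠ 0) (hu : u ≠ 0) :
    theta u (r ^ 2) = (qPochInf (r ^ 2) (r ^ 2))⁻¹ * thetaSeries r (-u / r) := by
  have hp := norm_sq_lt_one hr
  have hv : -u / r ≠ 0 := div_ne_zero (neg_ne_zero.mpr hu) hr0
  obtain ⟨M, hM⟩ := exists_norm_qFactInv_le hp
  obtain ⟨N, hN⟩ := exists_norm_qPoch_le hp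
  have hM0 : 0 ≤ M := (norm_nonneg _).trans (hM 0)
  have hN0 : 0 ≤ N := (norm_nonneg _).trans (hN 0)
  have hlim : Tendsto (fun n => qPoch u (r ^ 2) n * qPoch (r ^ 2 / u) (r ^ 2) n) atTop
      (𝓝 (theta u (r ^ 2))) := (tendsto_qPoch u hp).mul (tendsto_qPoch _ hp)
  have hcast : Tendsto (fun n : ℕ => (n : ℤ)) atTop atTop := tendsto_natCast_atTop_atTop
  have hdom := tendsto_tsum_of_dominated_convergence (𝓕 := atTop)
    (f := fun (n : ℕ) (k : ℤ) => qPoch (r ^ 2) (r ^ 2) (2 * n) * qFactInv (r ^ 2) (n + k) *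
        qFactInv (r ^ 2) (n - k) * (r ^ (k * k) * (-u / r) ^ k))
    (g := fun k : ℤ => (qPochInf (r ^ 2) (r ^ 2))⁻¹ * (r ^ (k * k) * (-u / r) ^ k))
    (bound := fun k : ℤ => N * M * M * ‖r ^ (k * k) * (-u / r) ^ k‖)
    ((summable_norm_thetaSeries hr hr0 hv).mul_left _) (fun k => ?_)
    (Eventually.of_forall fun n k => ?_)
  · rw [tsum_mul_left] at hdom
    refine tendsto_nhds_unique hlim (hdom.congr fun n => ?_)
    exact (hasSum_finite_triple_product hr hr0 hu n).tsum_eq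
  · have h1 := (tendsto_qPoch (r ^ 2) hp).comp
      (tendsto_id.const_mul_atTop' (by norm_num : 0 < 2) : Tendsto (fun n : ℕ => 2 * n) atTop atTop)
    have h2 := tendsto_qFactInv hp (tendsto_atTop_add_const_right atTop k hcast)
    have h3 := tendsto_qFactInv hp (tendsto_atTop_add_const_right atTop (-k) hcast)
    have h4 := ((h1.mul h2).mul h3).mul_const (r ^ (k * k) * (-u / r) ^ k)
    rw [mul_inv_cancel₀ (qPochInf_self_ne_zero hp), one_mul] at h4
    simpa [sub_eq_add_neg] using h4
  · rw [norm_mul, norm_mul, norm_mul]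
    gcongr
    exacts [hN _, hM _, hM _]

/-- Pairs of integers, split according to the parity of their sum. -/
def intPairParity : (ℤ × ℤ) ⊕ (ℤ × ℤ) ≃ ℤ × ℤ where
  toFun := Sum.elim (fun a => (a.1 + a.2, a.1 - a.2)) (fun a => (a.1 + a.2 + 1, a.1 - a.2))
  invFun b := if (b.1 + b.2) % 2 = 0 then Sum.inl ((b.1 + b.2) / 2, (b.1 - b.2) / 2)
    else Sum.inr ((b.1 + b.2 - 1) / 2, (b.1 - b.2 - 1) / 2)
  left_inv := by
    rintro (⟨i, j⟩ | ⟨i, j⟩)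
    · have h : (i + j + (i - j)) % 2 = 0 := by omega
      simp only [Sum.elim_inl, h, if_true, Sum.inl.injEq, Prod.mk.injEq]
      omega
    · have h : ¬ (i + j + 1 + (i - j)) % 2 = 0 := by omega
      simp only [Sum.elim_inr, h, if_false, Sum.inr.injEq, Prod.mk.injEq]
      omega
  right_inv := by
    rintro ⟨m, n⟩
    by_cases h : (m + n) % 2 = 0
    · simp only [h, if_true, Sum.elim_inl, Prod.mk.injEq]
      omega
    · simp only [h, if_false, Sum.elim_inr, Prod.mk.injEq]
      omega

theorem hasSum_thetaSeries_mul {r s a b : ℂ} (hr : ‖r‖ < 1) (hr0 : r ≠ 0) (hs : ‖s‖ < 1)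
    (hs0 : s ≠ 0) (ha : a ≠ 0) (hb : b ≠ 0) :
    HasSum (fun k : ℤ × ℤ => r ^ (k.1 * k.1) * a ^ k.1 * (s ^ (k.2 * k.2) * b ^ k.2))
      (thetaSeries r a * thetaSeries s b) := by
  have h1 := summable_norm_thetaSeries hr hr0 ha
  have h2 := summable_norm_thetaSeries hs hs0 hb
  rw [thetaSeries, thetaSeries, tsum_mul_tsum_of_summable_norm h1 h2]
  exact (summable_mul_of_summable_norm h1 h2).hasSum

theorem thetaSeries_mul_thetaSeries {r a b : ℂ} (hr : ‖r‖ < 1) (hr0 : r ≠ 0) (ha : a ≠ 0)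
    (hb : b ≠ 0) :
    thetaSeries r a * thetaSeries r b =
      thetaSeries (r ^ 2) (a * b) * thetaSeries (r ^ 2) (a / b) +
        r * a * (thetaSeries (r ^ 2) (r ^ 2 * (a * b)) * thetaSeries (r ^ 2) (r ^ 2 * (a / b))) := by
  have hp := norm_sq_lt_one hr
  have hp0 : r ^ 2 ≠ 0 := pow_ne_zero 2 hr0
  have hab := mul_ne_zero ha hb
  have hab' := div_ne_zero ha hb
  have h1 := hasSum_thetaSeries_mul hp hp0 hp hp0 hab hab'
  have h2 := (hasSum_thetaSeries_mul hp hp0 hp hp0 (mul_ne_zero hp0 hab)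
    (mul_ne_zero hp0 hab')).mul_left (r * a)
  have h3 := intPairParity.hasSum_iff.mpr (hasSum_thetaSeries_mul hr hr0 hr hr0 ha hb)
  refine h3.unique (HasSum.sum (?_ : HasSum _ _) ?_)
  · refine h1.congr_fun ?_
    rintro ⟨i, j⟩
    simp only [Function.comp, intPairParity, Equiv.coe_fn_mk, Sum.elim_inl]
    have e : r ^ ((i + j) * (i + j)) * r ^ ((i - j) * (i - j)) =
        (r ^ 2) ^ (i * i) * (r ^ 2) ^ (j * j) := by
      rw [pow_two, mul_zpow, mul_zpow]
      simp only [← zpow_add₀ hr0]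
      congr 1; ring
    rw [zpow_add₀ ha, zpow_sub₀ hb, mul_zpow, div_zpow]
    linear_combination (a ^ i * a ^ j * (b ^ i / b ^ j)) * e
  · refine h2.congr_fun ?_
    rintro ⟨i, j⟩
    simp only [Function.comp, intPairParity, Equiv.coe_fn_mk, Sum.elim_inr]
    have e : r ^ ((i + j + 1) * (i + j + 1)) * r ^ ((i - j) * (i - j)) =
        r * ((r ^ 2) ^ (i * i) * (r ^ 2) ^ (j * j)) * ((r ^ 2) ^ i * (r ^ 2) ^ j) := by
      rw [pow_two, mul_zpow, mul_zpow, mul_zpow, mul_zpow]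
      nth_rewrite 3 [← zpow_one r]
      simp only [← zpow_add₀ hr0]
      congr 1; ring
    rw [zpow_add₀ ha, zpow_add₀ ha, zpow_one, zpow_sub₀ hb, mul_zpow, mul_zpow, mul_zpow, div_zpow]
    linear_combination (a ^ i * a ^ j * a * (b ^ i / b ^ j)) * e

theorem thetaSeries_div_self {p v : ℂ} (hp : ‖p‖ < 1) (hp0 : p ≠ 0) (hv : v ≠ 0) :
    thetaSeries p (v / p) = v * thetaSeries p (p * v) := by
  have h1 := (Equiv.addRight (1 : ℤ)).hasSum_iff.mpr
    (hasSum_thetaSeries hp hp0 (div_ne_zero hv hp0))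
  refine h1.unique ?_
  refine HasSum.congr_fun (f := fun k : ℤ => v * (p ^ (k * k) * (p * v) ^ k))
    ((hasSum_thetaSeries hp hp0 (mul_ne_zero hp0 hv)).mul_left v) fun k => ?_
  simp only [Function.comp, Equiv.coe_addRight]
  have e : p ^ ((k + 1) * (k + 1)) = p ^ (k * k) * p ^ k * (p ^ k * p) := by
    rw [← zpow_add_one₀ hp0, ← zpow_add₀ hp0, ← zpow_add₀ hp0]; congr 1; ring
  rw [e, zpow_add_one₀ (div_ne_zero hv hp0), div_zpow, mul_zpow]
  have := zpow_ne_zero k hp0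
  field_simp

theorem theta_mul_theta_div {r x y : ℂ} (hr : ‖r‖ < 1) (hr0 : r ≠ 0) (hx : x ≠ 0) (hy : y ≠ 0) :
    theta (x * y) (r ^ 2) * theta (x / y) (r ^ 2) =
      (qPochInf (r ^ 2) (r ^ 2))⁻¹ ^ 2 * x *
        (x * thetaSeries (r ^ 2) (r ^ 2 * x ^ 2) * thetaSeries (r ^ 2) (y ^ 2) -
          thetaSeries (r ^ 2) (x ^ 2) * (y * thetaSeries (r ^ 2) (r ^ 2 * y ^ 2))) := by
  have hp := norm_sq_lt_one hr
  have hp0 : r ^ 2 ≠ 0 := pow_ne_zero 2 hr0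
  have h := thetaSeries_mul_thetaSeries hr hr0
    (div_ne_zero (neg_ne_zero.mpr (mul_ne_zero hx hy)) hr0)
    (div_ne_zero (neg_ne_zero.mpr (div_ne_zero hx hy)) hr0)
  have e1 : -(x * y) / r * (-(x / y) / r) = x ^ 2 / r ^ 2 := by field_simp
  have e2 : -(x * y) / r / (-(x / y) / r) = y ^ 2 := by field_simp
  have e3 : r ^ 2 * (x ^ 2 / r ^ 2) = x ^ 2 := by field_simp
  have e4 : r * (-(x * y) / r) = -(x * y) := by field_simp
  rw [e1, e2, e3, e4, thetaSeries_div_self hp hp0 (pow_ne_zero 2 hx)] at h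
  rw [theta_sq_eq_thetaSeries hr hr0 (mul_ne_zero hx hy),
    theta_sq_eq_thetaSeries hr hr0 (div_ne_zero hx hy)]
  linear_combination (qPochInf (r ^ 2) (r ^ 2))⁻¹ ^ 2 * h

/-- The three-term relation for theta functions. -/
theorem theta_three_term {p x y u v : ℂ} (hp : ‖p‖ < 1) (hp0 : p ≠ 0) (hx : x ≠ 0) (hy : y ≠ 0)
    (hu : u ≠ 0) (hv : v ≠ 0) :
    theta (x * y) p * theta (x / y) p * (theta (u * v) p * theta (u / v) p) -
      theta (x * v) p * theta (x / v) p * (theta (u * y) p * theta (u / y) p) =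
      u / y * (theta (y * v) p * theta (y / v) p * (theta (x * u) p * theta (x / u) p)) := by
  obtain ⟨r, rfl⟩ := IsAlgClosed.exists_pow_nat_eq p two_pos
  have hr0 : r ≠ 0 := by rintro rfl; simp at hp0
  have hr : ‖r‖ < 1 := by
    rw [norm_pow] at hp
    exact (pow_lt_one_iff_of_nonneg (norm_nonneg r) two_ne_zero).mp hp
  rw [theta_mul_theta_div hr hr0 hx hy, theta_mul_theta_div hr hr0 hu hv,
    theta_mul_theta_div hr hr0 hx hv, theta_mul_theta_div hr hr0 hu hy,
    theta_mul_theta_div hr hr0 hy hv, theta_mul_theta_div hr hr0 hx hu]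
  field_simp
  ring

theorem qPochInf_eq_one_sub_mul (u : ℂ) {p : ℂ} (hp : ‖p‖ < 1) :
    qPochInf u p = (1 - u) * qPochInf (p * u) p := by
  refine tendsto_nhds_unique ((tendsto_qPoch u hp).comp (tendsto_add_atTop_nat 1))
    (((tendsto_qPoch (p * u) hp).const_mul (1 - u)).congr fun n => ?_)
  simp only [Function.comp, qPoch, Finset.prod_range_succ', pow_zero, mul_one]
  rw [mul_comm]
  congr 1
  exact Finset.prod_congr rfl fun i _ => by ring

theorem qPochInf_eq_mul_sq (u : ℂ) {h : ℂ} (hh : ‖h‖ < 1) :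
    qPochInf u h = qPochInf u (h ^ 2) * qPochInf (h * u) (h ^ 2) := by
  have e0 : (fun i : ℕ => 1 - u * h ^ (2 * i)) = fun i => 1 - u * (h ^ 2) ^ i := by
    funext i; rw [pow_mul]
  have e1 : (fun i : ℕ => 1 - u * h ^ (2 * i + 1)) = fun i => 1 - h * u * (h ^ 2) ^ i := by
    funext i; rw [pow_succ, pow_mul]; ring
  have hp := norm_sq_lt_one hh
  unfold qPochInf
  rw [← e0, ← e1]
  refine (tprod_even_mul_odd (f := fun i => 1 - u * h ^ i) ?_ ?_).symm
  · rw [e0]; exact multipliable_qPochInf u hp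
  · rw [e1]; exact multipliable_qPochInf (h * u) hp

theorem qPochInf_sq (u : ℂ) {h : ℂ} (hh : ‖h‖ < 1) :
    qPochInf (u ^ 2) (h ^ 2) = qPochInf u h * qPochInf (-u) h := by
  unfold qPochInf
  rw [← (multipliable_qPochInf u hh).tprod_mul (multipliable_qPochInf (-u) hh)]
  congr 1
  funext i
  ring

theorem theta_nome_div {u p : ℂ} (hp0 : p ≠ 0) : theta (p / u) p = theta u p := by
  rw [theta, theta, div_div_cancel₀ hp0, mul_comm]

theorem theta_inv {u p : ℂ} (hp : ‖p‖ < 1) (hu : u ≠ 0) :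
    theta u⁻¹ p = -u⁻¹ * theta u p := by
  unfold theta
  rw [qPochInf_eq_one_sub_mul u⁻¹ hp, div_inv_eq_mul, qPochInf_eq_one_sub_mul u hp,
    ← div_eq_mul_inv]
  field_simp
  ring

theorem theta_eq_mul_sq {u h : ℂ} (hh : ‖h‖ < 1) (hh0 : h ≠ 0) (hu : u ≠ 0) :
    theta u h = theta u (h ^ 2) * theta (h * u) (h ^ 2) := by
  unfold theta
  rw [qPochInf_eq_mul_sq u hh, qPochInf_eq_mul_sq (h / u) hh]
  rw [show h ^ 2 / (h * u) = h / u by field_simp, show h * (h / u) = h ^ 2 / u by ring]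
  ring

theorem theta_sq {u h : ℂ} (hh : ‖h‖ < 1) : theta (u ^ 2) (h ^ 2) = theta u h * theta (-u) h := by
  unfold theta
  rw [← div_pow, qPochInf_sq u hh, qPochInf_sq (h / u) hh, div_neg]
  ring

section QuadraticRelations

variable {r K L X Y : ℂ}

theorem theta_quadratic_half (hr : ‖r‖ < 1) (hr0 : r ≠ 0) (hK : K ≠ 0) (hL : L ≠ 0) (hX : X ≠ 0)
    (hY : Y ≠ 0) :
    theta (-(r * L / Y)) (r ^ 2) * theta (-(r ^ 2 * X / (Y ^ 2 * K * L))) ((r ^ 2) ^ 2) *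
        theta (-(r * Y * X / K)) (r ^ 2) -
      theta (-(r * L * Y)) (r ^ 2) * theta (-(r * X / (Y * K))) (r ^ 2) *
        theta (-(r ^ 2 * Y ^ 2 * X / (K * L))) ((r ^ 2) ^ 2) =
      r * X * Y / K * theta (-(K / (L * X))) ((r ^ 2) ^ 2) * theta (K * L / X) (r ^ 2) *
        theta (Y ^ 2)⁻¹ (r ^ 2) := by
  obtain ⟨a, ha⟩ := IsAlgClosed.exists_pow_nat_eq L two_pos
  obtain ⟨b, hb⟩ := IsAlgClosed.exists_pow_nat_eq (X / K) two_pos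
  have ha0 : a ≠ 0 := by rintro rfl; exact hL (by simpa using ha.symm)
  have hb0 : b ≠ 0 := by rintro rfl; exact div_ne_zero hX hK (by simpa using hb.symm)
  obtain rfl : X = b ^ 2 * K := by rw [hb]; field_simp
  subst ha
  have hI : Complex.I ≠ 0 := Complex.I_ne_zero
  have hI2 : Complex.I ^ 2 = -1 := Complex.I_sq
  have hh := norm_sq_lt_one hr
  have hh0 : r ^ 2 ≠ 0 := pow_ne_zero 2 hr0
  have hp0 : (r ^ 2) ^ 2 ≠ 0 := pow_ne_zero 2 hh0
  have key := theta_three_term hh hh0 (x := -(r * a / (b * Y))) (u := -(r * a * Y / b))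
    (y := (a * b)⁻¹) (v := Complex.I) (neg_ne_zero.mpr (by positivity)) (by positivity)
    (neg_ne_zero.mpr (by positivity)) hI
  have e1 : theta (-(r * a / (b * Y)) * (a * b)⁻¹) (r ^ 2) = theta (-(r * b ^ 2 * Y)) (r ^ 2) := by
    rw [← theta_nome_div hh0]; congr 1; field_simp
  have e2 : -(r * a / (b * Y)) / (a * b)⁻¹ = -(r * a ^ 2 / Y) := by field_simp
  have e3 : theta (-(r * a * Y / b) * Complex.I) (r ^ 2) * theta (-(r * a * Y / b) / Complex.I) (r ^ 2)
      = theta (-(r ^ 2 / (Y ^ 2 * a ^ 2) * b ^ 2)) ((r ^ 2) ^ 2) := by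
    rw [← theta_nome_div hp0,
      show (r ^ 2) ^ 2 / -(r ^ 2 / (Y ^ 2 * a ^ 2) * b ^ 2) =
        (-(r * a * Y / b) * Complex.I) ^ 2 by rw [mul_pow, hI2]; field_simp, theta_sq hh]
    rw [Complex.div_I, neg_mul_eq_mul_neg]
  have e4 : theta (-(r * a / (b * Y)) * Complex.I) (r ^ 2) *
      theta (-(r * a / (b * Y)) / Complex.I) (r ^ 2)
      = theta (-(r ^ 2 * Y ^ 2 * b ^ 2 / a ^ 2)) ((r ^ 2) ^ 2) := by
    rw [← theta_nome_div hp0,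
      show (r ^ 2) ^ 2 / -(r ^ 2 * Y ^ 2 * b ^ 2 / a ^ 2) =
        (-(r * a / (b * Y)) * Complex.I) ^ 2 by rw [mul_pow, hI2]; field_simp, theta_sq hh]
    rw [Complex.div_I, neg_mul_eq_mul_neg]
  have e5 : theta (-(r * a * Y / b) * (a * b)⁻¹) (r ^ 2) = theta (-(r * b ^ 2 / Y)) (r ^ 2) := by
    rw [← theta_nome_div hh0]; congr 1; field_simp
  have e6 : -(r * a * Y / b) / (a * b)⁻¹ = -(r * a ^ 2 * Y) := by field_simp
  have e7 : theta ((a * b)⁻¹ * Complex.I) (r ^ 2) * theta ((a * b)⁻¹ / Complex.I) (r ^ 2) =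
      theta (-(a ^ 2 * b ^ 2)⁻¹) ((r ^ 2) ^ 2) := by
    rw [show -(a ^ 2 * b ^ 2)⁻¹ = ((a * b)⁻¹ * Complex.I) ^ 2 by
      rw [mul_pow, hI2]; field_simp, theta_sq hh]
    congr 2
    rw [Complex.div_I]
  have e8 : theta (-(r * a / (b * Y)) * -(r * a * Y / b)) (r ^ 2) =
      -(b ^ 2 / a ^ 2) * theta (a ^ 2 / b ^ 2) (r ^ 2) := by
    rw [show b ^ 2 / a ^ 2 = (a ^ 2 / b ^ 2)⁻¹ by field_simp, ← theta_inv hh (by simp [ha0, hb0]),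
      ← theta_nome_div hh0]
    congr 1; field_simp
  have e9 : -(r * a / (b * Y)) / -(r * a * Y / b) = (Y ^ 2)⁻¹ := by field_simp
  rw [e1, e2, e3, e4, e5, e6, e7, e8, e9] at key
  have d1 : r ^ 2 * (b ^ 2 * K) / (Y ^ 2 * K * a ^ 2) = r ^ 2 / (Y ^ 2 * a ^ 2) * b ^ 2 := by
    field_simp
  have d2 : r * Y * (b ^ 2 * K) / K = r * b ^ 2 * Y := by field_simp
  have d3 : r * (b ^ 2 * K) / (Y * K) = r * b ^ 2 / Y := by field_simp
  have d4 : r ^ 2 * Y ^ 2 * (b ^ 2 * K) / (K * a ^ 2) = r ^ 2 * Y ^ 2 * b ^ 2 / a ^ 2 := by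
    field_simp
  have d5 : K / (a ^ 2 * (b ^ 2 * K)) = (a ^ 2 * b ^ 2)⁻¹ := by field_simp
  have d6 : K * a ^ 2 / (b ^ 2 * K) = a ^ 2 / b ^ 2 := by field_simp
  have d7 : r * (b ^ 2 * K) * Y / K = r * a ^ 2 * Y * (b ^ 2 / a ^ 2) := by field_simp
  rw [d1, d2, d3, d4, d5, d6, d7]
  linear_combination key

theorem theta_quadratic_full (hr : ‖r‖ < 1) (hr0 : r ≠ 0) (hK : K ≠ 0) (hL : L ≠ 0) (hX : X ≠ 0)
    (hY : Y ≠ 0) :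
    theta (-(r ^ 2 * K * X / L)) ((r ^ 2) ^ 2) *
        theta (-(r ^ 2 * Y ^ 2 / (X * K * L))) ((r ^ 2) ^ 2) * theta (-(r * Y * X / K)) (r ^ 2) -
      theta (-(r ^ 2 * K / (L * X))) ((r ^ 2) ^ 2) * theta (-(r * Y / (X * K))) (r ^ 2) *
        theta (-(r ^ 2 * Y ^ 2 * X / (K * L))) ((r ^ 2) ^ 2) =
      -(r * Y / (K * X)) * theta (X ^ 2) ((r ^ 2) ^ 2) * theta (K ^ 2 / Y ^ 2) ((r ^ 2) ^ 2) *
        theta (r * L / Y) (r ^ 2) := by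
  have hh := norm_sq_lt_one hr
  have hh0 : r ^ 2 ≠ 0 := pow_ne_zero 2 hr0
  have hp := norm_sq_lt_one hh
  have hp0 : (r ^ 2) ^ 2 ≠ 0 := pow_ne_zero 2 hh0
  have key := theta_three_term hp hp0 (x := -(r ^ 2 * L / Y)) (u := -r)
    (y := K * X / Y) (v := X * Y / K) (neg_ne_zero.mpr (by positivity)) (by positivity)
    (neg_ne_zero.mpr hr0) (by positivity)
  have e1 : theta (-(r ^ 2 * L / Y) * (K * X / Y)) ((r ^ 2) ^ 2) =
      theta (-(r ^ 2 * Y ^ 2 / (X * K * L))) ((r ^ 2) ^ 2) := by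
    rw [← theta_nome_div hp0]; congr 1; field_simp
  have e2 : theta (-(r ^ 2 * L / Y) / (K * X / Y)) ((r ^ 2) ^ 2) =
      theta (-(r ^ 2 * K * X / L)) ((r ^ 2) ^ 2) := by
    rw [← theta_nome_div hp0]; congr 1; field_simp
  have e3 : theta (-r * (X * Y / K)) ((r ^ 2) ^ 2) * theta (-r / (X * Y / K)) ((r ^ 2) ^ 2) =
      theta (-(r * Y * X / K)) (r ^ 2) := by
    rw [theta_eq_mul_sq hh hh0 (by simp [hr0, hK, hX, hY]), ← theta_nome_div (u := -r / (X * Y / K)) hp0]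
    congr 2
    · ring
    · field_simp
  have e4 : theta (-(r ^ 2 * L / Y) * (X * Y / K)) ((r ^ 2) ^ 2) =
      theta (-(r ^ 2 * K / (L * X))) ((r ^ 2) ^ 2) := by
    rw [← theta_nome_div hp0]; congr 1; field_simp
  have e5 : theta (-(r ^ 2 * L / Y) / (X * Y / K)) ((r ^ 2) ^ 2) =
      theta (-(r ^ 2 * Y ^ 2 * X / (K * L))) ((r ^ 2) ^ 2) := by
    rw [← theta_nome_div hp0]; congr 1; field_simp
  have e6 : theta (-r * (K * X / Y)) ((r ^ 2) ^ 2) * theta (-r / (K * X / Y)) ((r ^ 2) ^ 2) =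
      theta (-(r * Y / (X * K))) (r ^ 2) := by
    rw [theta_eq_mul_sq hh hh0 (by simp [hr0, hK, hX, hY]), mul_comm,
      ← theta_nome_div (u := -r * (K * X / Y)) hp0]
    congr 2
    · field_simp
    · field_simp
  have e7 : K * X / Y * (X * Y / K) = X ^ 2 := by field_simp
  have e8 : K * X / Y / (X * Y / K) = K ^ 2 / Y ^ 2 := by field_simp
  have e9 : theta (-(r ^ 2 * L / Y) * -r) ((r ^ 2) ^ 2) * theta (-(r ^ 2 * L / Y) / -r) ((r ^ 2) ^ 2)
      = theta (r * L / Y) (r ^ 2) := by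
    rw [theta_eq_mul_sq hh hh0 (by simp [hr0, hL, hY]), mul_comm]
    congr 2
    · field_simp
    · ring
  have e10 : -r / (K * X / Y) = -(r * Y / (K * X)) := by field_simp
  rw [e3, e6, e9, e1, e2, e4, e5, e7, e8, e10] at key
  linear_combination key

end QuadraticRelations

end ThetaFunctions

section ConnectionCoefficients

variable {q s : ℝ}

theorem qc_ne_zero (q : ℝ) (x : ℂ) : qc q x ≠ 0 := Complex.exp_ne_zero _

theorem qc_neg (q : ℝ) (x : ℂ) : qc q (-x) = (qc q x)⁻¹ := by
  rw [qc, qc, neg_mul, Complex.exp_neg]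

theorem norm_qc_lt_one (hq0 : 0 < q) (hq1 : q < 1) {t : ℝ} (ht : 0 < t) : ‖qc q t‖ < 1 := by
  rw [qc, ← Complex.ofReal_log hq0.le, ← Complex.ofReal_mul, Complex.norm_exp_ofReal]
  exact Real.exp_lt_one_iff.mpr (mul_neg_of_pos_of_neg ht (Real.log_neg hq0 hq1))

theorem qc_half_step (q s : ℝ) : qc q (s / 2) = qc q (s / 4) ^ 2 := by
  rw [qc, qc, ← Complex.exp_nat_mul]; congr 1; push_cast; ring

theorem qc_step (q s : ℝ) : qc q s = (qc q (s / 4) ^ 2) ^ 2 := by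
  rw [qc, qc, ← Complex.exp_nat_mul, ← Complex.exp_nat_mul]; congr 1; push_cast; ring

theorem norm_qc_div_four_lt_one (hq0 : 0 < q) (hq1 : q < 1) (hs : 0 < s) :
    ‖qc q (s / 4)‖ < 1 := by
  have := norm_qc_lt_one hq0 hq1 (show 0 < s / 4 by positivity)
  push_cast at this
  exact this

theorem cF_eq_of_dual_params (hq0 : 0 < q) (hq1 : q < 1) (hs : 0 < s) (k lm : ℝ) (x y : ℂ)
    {r K L X Y : ℂ} (hr : r = qc q (s / 4)) (hK : K = qc q k) (hL : L = qc q lm) (hX : X = qc q x)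
    (hY : Y = qc q y) (hc : cDef q s k lm k lm x (2 * y)) :
    theta (Y ^ 2)⁻¹ (r ^ 2) * theta (-(r ^ 2 * Y ^ 2)) ((r ^ 2) ^ 2) *
        theta (-(r ^ 2 * K * X / L)) ((r ^ 2) ^ 2) ≠ 0 ∧
      cF q s k lm k lm x (2 * y) =
        theta (K ^ 2 / Y ^ 2) ((r ^ 2) ^ 2) * theta (r ^ 2 * L ^ 2 / Y ^ 2) ((r ^ 2) ^ 2) *
          theta (-(r ^ 2 * X / (Y ^ 2 * K * L))) ((r ^ 2) ^ 2) /
        (Wgt q s k lm k x (2 * y) * (theta (Y ^ 2)⁻¹ (r ^ 2) *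
          theta (-(r ^ 2 * Y ^ 2)) ((r ^ 2) ^ 2) * theta (-(r ^ 2 * K * X / L)) ((r ^ 2) ^ 2))) := by
  have hr1 : ‖r‖ < 1 := hr ▸ norm_qc_div_four_lt_one hq0 hq1 hs
  have hr0 : r ≠ 0 := hr ▸ qc_ne_zero _ _
  have hY0 : Y ≠ 0 := hY ▸ qc_ne_zero _ _
  have hh := norm_sq_lt_one hr1
  have hh0 : r ^ 2 ≠ 0 := pow_ne_zero 2 hr0
  have hp0 : (r ^ 2) ^ 2 ≠ 0 := pow_ne_zero 2 hh0
  have e1 : aP q k k * qc q (-(2 * y)) = K ^ 2 / Y ^ 2 := by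
    subst hK hY
    simp only [aP, qc, ← Complex.exp_add, ← Complex.exp_nat_mul, ← Complex.exp_sub]
    congr 1; push_cast; ring
  have e2 : bP q k k * qc q (-(2 * y)) = -(Y ^ 2)⁻¹ := by
    subst hY
    simp only [bP, qc, neg_mul, ← Complex.exp_add, ← Complex.exp_nat_mul, ← Complex.exp_neg]
    refine congrArg Neg.neg (congrArg Complex.exp ?_)
    push_cast; ring
  have e3 : cP q s lm lm * qc q (-(2 * y)) = r ^ 2 * L ^ 2 / Y ^ 2 := by
    subst hr hL hY
    simp only [cP, qc, ← Complex.exp_add, ← Complex.exp_nat_mul, ← Complex.exp_sub]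
    congr 1; push_cast; ring
  have e4 : dP q s k lm * qc q (x - 2 * y) / aP q k k = -(r ^ 2 * X / (Y ^ 2 * K * L)) := by
    subst hr hK hL hX hY
    simp only [dP, aP, qc, neg_mul, neg_div, ← Complex.exp_add, ← Complex.exp_nat_mul,
      ← Complex.exp_sub]
    refine congrArg Neg.neg (congrArg Complex.exp ?_)
    push_cast; ring
  have e5 : qc q (-(2 * (2 * y))) = (Y ^ 2)⁻¹ ^ 2 := by
    subst hY
    simp only [qc, ← Complex.exp_nat_mul, ← Complex.exp_neg]
    congr 1; push_cast; ring
  have e6 : dP q s k lm * qc q x = -(r ^ 2 * K * X / L) := by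
    subst hr hK hL hX
    simp only [dP, qc, neg_mul, ← Complex.exp_add, ← Complex.exp_nat_mul, ← Complex.exp_sub]
    refine congrArg Neg.neg (congrArg Complex.exp ?_)
    push_cast; ring
  have e7 : theta (r ^ 2 * -(Y ^ 2)⁻¹) ((r ^ 2) ^ 2) = theta (-(r ^ 2 * Y ^ 2)) ((r ^ 2) ^ 2) := by
    rw [← theta_nome_div hp0]; congr 1; field_simp
  have e8 : theta (-(Y ^ 2)⁻¹) (r ^ 2) =
      theta (-(Y ^ 2)⁻¹) ((r ^ 2) ^ 2) * theta (-(r ^ 2 * Y ^ 2)) ((r ^ 2) ^ 2) := by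
    rw [theta_eq_mul_sq hh hh0 (by simp [hY0]), e7]
  have hp : qc q s = (r ^ 2) ^ 2 := hr ▸ qc_step q s
  unfold cDef at hc
  rw [e5, e6, hp, theta_sq hh, e8] at hc
  simp only [ne_eq, mul_eq_zero, not_or] at hc
  obtain ⟨⟨h1, h2, h3⟩, h4⟩ := hc
  have hW : Wgt q s k lm k x (2 * y) ≠ 0 := qc_ne_zero _ _
  refine ⟨by simp [h1, h3, h4], ?_⟩
  unfold cF
  rw [e1, e2, e3, e4, e5, e6, hp, theta_sq hh, e8]
  generalize theta (-(Y ^ 2)⁻¹) ((r ^ 2) ^ 2) = A at *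
  generalize theta (Y ^ 2)⁻¹ (r ^ 2) = B at *
  field_simp

theorem cF_dual_eq_of_dual_params (hq0 : 0 < q) (hq1 : q < 1) (hs : 0 < s) (k lm : ℝ) (x y : ℂ)
    {r K L X Y : ℂ} (hr : r = qc q (s / 4)) (hK : K = qc q k) (hL : L = qc q lm) (hX : X = qc q x)
    (hY : Y = qc q y) (hc : cDef q s k k lm lm (2 * y) x) :
    theta (X ^ 2)⁻¹ ((r ^ 2) ^ 2) * theta (-(r ^ 2 * Y ^ 2)) ((r ^ 2) ^ 2) ≠ 0 ∧
      cF q s k k lm lm (2 * y) x =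
        theta (K * L / X) (r ^ 2) * theta (-(K / (L * X))) ((r ^ 2) ^ 2) *
          theta (-(r ^ 2 * Y ^ 2 / (X * K * L))) ((r ^ 2) ^ 2) /
        (Wgt q s k k lm (2 * y) x *
          (theta (X ^ 2)⁻¹ ((r ^ 2) ^ 2) * theta (-(r ^ 2 * Y ^ 2)) ((r ^ 2) ^ 2))) := by
  have hr1 : ‖r‖ < 1 := hr ▸ norm_qc_div_four_lt_one hq0 hq1 hs
  have hr0 : r ≠ 0 := hr ▸ qc_ne_zero _ _
  have hh := norm_sq_lt_one hr1
  have hh0 : r ^ 2 ≠ 0 := pow_ne_zero 2 hr0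
  have hKLX : K * L / X ≠ 0 := by
    subst hK hL hX
    exact div_ne_zero (mul_ne_zero (qc_ne_zero _ _) (qc_ne_zero _ _)) (qc_ne_zero _ _)
  have e1 : aP q k lm * qc q (-x) = K * L / X := by
    subst hK hL hX
    simp only [aP, qc, ← Complex.exp_add, ← Complex.exp_sub]
    congr 1; ring
  have e2 : bP q k lm * qc q (-x) = -(K / (L * X)) := by
    subst hK hL hX
    simp only [bP, qc, neg_mul, ← Complex.exp_add, ← Complex.exp_sub]
    refine congrArg Neg.neg (congrArg Complex.exp ?_)
    ring
  have e3 : cP q s k lm * qc q (-x) = r ^ 2 * (K * L / X) := by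
    subst hr hK hL hX
    simp only [cP, qc, ← Complex.exp_add, ← Complex.exp_nat_mul, ← Complex.exp_sub]
    congr 1; push_cast; ring
  have e4 : dP q s lm lm * qc q (2 * y - x) / aP q k lm = -(r ^ 2 * Y ^ 2 / (X * K * L)) := by
    subst hr hK hL hX hY
    simp only [dP, aP, qc, neg_mul, neg_div, ← Complex.exp_add, ← Complex.exp_nat_mul,
      ← Complex.exp_sub]
    refine congrArg Neg.neg (congrArg Complex.exp ?_)
    push_cast; ring
  have e5 : qc q (-(2 * x)) = (X ^ 2)⁻¹ := by
    subst hX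
    simp only [qc, ← Complex.exp_nat_mul, ← Complex.exp_neg]
    congr 1; push_cast; ring
  have e6 : dP q s lm lm * qc q (2 * y) = -(r ^ 2 * Y ^ 2) := by
    subst hr hY
    simp only [dP, qc, neg_mul, ← Complex.exp_add, ← Complex.exp_nat_mul]
    refine congrArg Neg.neg (congrArg Complex.exp ?_)
    push_cast; ring
  have hp : qc q s = (r ^ 2) ^ 2 := hr ▸ qc_step q s
  unfold cDef at hc
  rw [e5, e6, hp] at hc
  refine ⟨hc, ?_⟩
  unfold cF
  rw [e1, e2, e3, e4, e5, e6, hp, theta_eq_mul_sq hh hh0 hKLX]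
  ring

theorem cF_eq_of_half_step (hq0 : 0 < q) (hq1 : q < 1) (hs : 0 < s) (k lm : ℝ) (x y : ℂ)
    {r K L X Y : ℂ} (hr : r = qc q (s / 4)) (hK : K = qc q k) (hL : L = qc q lm) (hX : X = qc q x)
    (hY : Y = qc q y) (hc : cDef q (s / 2) k lm 0 0 x y) :
    theta (Y ^ 2)⁻¹ (r ^ 2) * theta (-(r * X)) (r ^ 2) ≠ 0 ∧
      cF q (s / 2) k lm 0 0 x y =
        theta (K ^ 2 / Y ^ 2) ((r ^ 2) ^ 2) * theta (r * L / Y) (r ^ 2) *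
          theta (-(r * X / (Y * K))) (r ^ 2) /
        (Wgt q (s / 2) k lm 0 x y * (theta (Y ^ 2)⁻¹ (r ^ 2) * theta (-(r * X)) (r ^ 2))) := by
  have hr1 : ‖r‖ < 1 := hr ▸ norm_qc_div_four_lt_one hq0 hq1 hs
  have hh := norm_sq_lt_one hr1
  have e1 : aP q k 0 * qc q (-y) = K / Y := by
    subst hK hY
    simp only [aP, qc, ← Complex.exp_add, ← Complex.exp_sub]
    congr 1; push_cast; ring
  have e2 : bP q k 0 * qc q (-y) = -(K / Y) := by
    subst hK hY
    simp only [bP, qc, neg_mul, ← Complex.exp_add, ← Complex.exp_sub]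
    refine congrArg Neg.neg (congrArg Complex.exp ?_)
    push_cast; ring
  have e3 : cP q (s / 2) lm 0 * qc q (-y) = r * L / Y := by
    subst hr hL hY
    simp only [cP, qc, ← Complex.exp_add, ← Complex.exp_sub]
    congr 1; push_cast; ring
  have e4 : dP q (s / 2) 0 0 * qc q (x - y) / aP q k 0 = -(r * X / (Y * K)) := by
    subst hr hK hX hY
    simp only [dP, aP, qc, neg_mul, neg_div, ← Complex.exp_add, ← Complex.exp_sub]
    refine congrArg Neg.neg (congrArg Complex.exp ?_)
    push_cast; ring
  have e5 : qc q (-(2 * y)) = (Y ^ 2)⁻¹ := by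
    subst hY
    simp only [qc, ← Complex.exp_nat_mul, ← Complex.exp_neg]
    congr 1; push_cast; ring
  have e6 : dP q (s / 2) 0 0 * qc q x = -(r * X) := by
    subst hr hX
    simp only [dP, qc, neg_mul, ← Complex.exp_add]
    refine congrArg Neg.neg (congrArg Complex.exp ?_)
    push_cast; ring
  have hp : qc q (s / 2 : ℝ) = r ^ 2 := by rw [hr, ← qc_half_step]; push_cast; rfl
  unfold cDef at hc
  rw [e5, e6, hp] at hc
  refine ⟨hc, ?_⟩
  unfold cF
  rw [e1, e2, e3, e4, e5, e6, hp, ← div_pow K Y, theta_sq hh]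

theorem cF_dual_eq_of_half_step (hq0 : 0 < q) (hq1 : q < 1) (hs : 0 < s) (k lm : ℝ) (x y : ℂ)
    {r K L X Y : ℂ} (hr : r = qc q (s / 4)) (hK : K = qc q k) (hL : L = qc q lm) (hX : X = qc q x)
    (hY : Y = qc q y) (hc : cDef q (s / 2) k 0 lm 0 y x) :
    theta (X ^ 2)⁻¹ ((r ^ 2) ^ 2) * theta (-(r * X)) (r ^ 2) * theta (-(r * L * Y)) (r ^ 2) ≠ 0 ∧
      cF q (s / 2) k 0 lm 0 y x =
        theta (K * L / X) (r ^ 2) * theta (-(K / (L * X))) (r ^ 2) *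
          theta (-(r * Y / (X * K))) (r ^ 2) /
        (Wgt q (s / 2) k 0 lm y x * (theta (X ^ 2)⁻¹ ((r ^ 2) ^ 2) * theta (-(r * X)) (r ^ 2) *
          theta (-(r * L * Y)) (r ^ 2))) := by
  have hr1 : ‖r‖ < 1 := hr ▸ norm_qc_div_four_lt_one hq0 hq1 hs
  have hr0 : r ≠ 0 := hr ▸ qc_ne_zero _ _
  have hX0 : X ≠ 0 := hX ▸ qc_ne_zero _ _
  have hh := norm_sq_lt_one hr1
  have hh0 : r ^ 2 ≠ 0 := pow_ne_zero 2 hr0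
  have e1 : aP q k lm * qc q (-x) = K * L / X := by
    subst hK hL hX
    simp only [aP, qc, ← Complex.exp_add, ← Complex.exp_sub]
    congr 1; ring
  have e2 : bP q k lm * qc q (-x) = -(K / (L * X)) := by
    subst hK hL hX
    simp only [bP, qc, neg_mul, ← Complex.exp_add, ← Complex.exp_sub]
    refine congrArg Neg.neg (congrArg Complex.exp ?_)
    ring
  have e3 : cP q (s / 2) 0 0 * qc q (-x) = r / X := by
    subst hr hX
    simp only [cP, qc, ← Complex.exp_add, ← Complex.exp_sub]
    congr 1; push_cast; ring
  have e4 : dP q (s / 2) lm 0 * qc q (y - x) / aP q k lm = -(r * Y / (X * K)) := by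
    subst hr hK hX hY
    simp only [dP, aP, qc, neg_mul, neg_div, ← Complex.exp_add, ← Complex.exp_sub]
    refine congrArg Neg.neg (congrArg Complex.exp ?_)
    push_cast; ring
  have e5 : qc q (-(2 * x)) = X⁻¹ ^ 2 := by
    subst hX
    simp only [qc, ← Complex.exp_nat_mul, ← Complex.exp_neg]
    congr 1; push_cast; ring
  have e6 : dP q (s / 2) lm 0 * qc q y = -(r * L * Y) := by
    subst hr hL hY
    simp only [dP, qc, neg_mul, ← Complex.exp_add]
    refine congrArg Neg.neg (congrArg Complex.exp ?_)
    push_cast; ring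
  have e7 : theta (X⁻¹ ^ 2) (r ^ 2) =
      theta (X ^ 2)⁻¹ ((r ^ 2) ^ 2) * (theta (r / X) (r ^ 2) * theta (-(r * X)) (r ^ 2)) := by
    have h1 : theta (-(r * X)) (r ^ 2) = theta (-(r / X)) (r ^ 2) := by
      rw [← theta_nome_div hh0]; congr 1; field_simp
    rw [h1, ← theta_sq hh, theta_eq_mul_sq hh hh0 (pow_ne_zero 2 (inv_ne_zero hX0)), inv_pow,
      div_pow, div_eq_mul_inv]
  have hp : qc q (s / 2 : ℝ) = r ^ 2 := by rw [hr, ← qc_half_step]; push_cast; rfl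
  unfold cDef at hc
  rw [e5, e6, hp, e7] at hc
  simp only [ne_eq, mul_eq_zero, not_or] at hc
  obtain ⟨⟨h1, h2, h3⟩, h4⟩ := hc
  have hW : Wgt q (s / 2) k 0 lm y x ≠ 0 := qc_ne_zero _ _
  refine ⟨by simp [h1, h3, h4], ?_⟩
  unfold cF
  rw [e1, e2, e3, e4, e5, e6, hp, e7]
  field_simp

theorem div_sub_div_eq_of_quadratic {F : Type*} [Field F]
    {a b₁ b₂ c d e e₂ f g g' i j l m n o t u v w w' y₁ y₂ r K X Y : F} (hX : X ≠ 0) (hw : w ≠ 0)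
    (hw' : w' ≠ 0) (hn : n ≠ 0) (hm : m ≠ 0) (ho : o ≠ 0) (hg : g ≠ 0) (hv : v ≠ 0) (hl : l ≠ 0)
    (hi : i ≠ 0) (hj : j ≠ 0) (ht : t ≠ 0) (hy₂ : y₂ ≠ 0) (hg' : g' = -(X ^ 2)⁻¹ * g)
    (hhalf : b₂ * c * y₂ - l * u * t = r * X * Y / K * e * d * n)
    (hfull : o * f * y₂ - e₂ * y₁ * t = -(r * Y / (K * X)) * g * a * b₁) :
    (a * (b₁ * b₂) * c / (w * (n * m * o)) - d * e * f / (w * (g' * m))) /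
        (i * j * t / (w' * (g * m))) =
      (a * b₁ * u / (w * (n * v)) - d * (e * e₂) * y₁ / (w * (g' * v * l))) /
        (i * (j * o) * y₂ / (w' * (g * v * l))) := by
  have key : a * b₁ * g * (b₂ * c * y₂ - l * u * t) +
      X ^ 2 * d * e * n * (o * f * y₂ - e₂ * y₁ * t) = 0 := by
    have hKX : -(r * Y / (K * X)) = -(r * X * Y / K) / X ^ 2 := by
      by_cases hK : K = 0
      · simp [hK]
      · field_simp
    rw [hhalf, hfull, hKX]
    field_simp
    ring
  subst hg'
  field_simp
  linear_combination key

end ConnectionCoefficients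

/-- the quadratic identities for the connection coefficients,
relating the c-functions with Hecke parameters `(κ,λ,κ,λ)` at step size `s` to
those with parameters `(κ,λ,0,0)` at step size `s/2`, together with the
explicit product formula for the common value in the first identity. -/
theorem stmt18 (q s k lm : ℝ) (hq0 : 0 < q) (hq1 : q < 1) (hs : 0 < s) (x z : ℂ)
    (hJ1 : cDef q s k lm k lm x (-z)) (hJ2 : cDef q s k lm k lm x z)
    (hJd1 : cDef q s k k lm lm z x) (hJd2 : cDef q s k k lm lm z (-x))
    (hR1 : cDef q (s / 2) k lm 0 0 x (-(z / 2))) (hR2 : cDef q (s / 2) k lm 0 0 x (z / 2))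
    (hRd1 : cDef q (s / 2) k 0 lm 0 (z / 2) x) (hRd2 : cDef q (s / 2) k 0 lm 0 (z / 2) (-x))
    (hc1 : cF q s k k lm lm z (-x) ≠ 0)
    (hc2 : cF q (s / 2) k 0 lm 0 (z / 2) (-x) ≠ 0)
    (hth : theta (qc q z) (qc q (s / 2)) * theta (qc q (k + lm + x)) (qc q (s / 2)) *
      theta (-qc q (k - lm + x)) (qc q (s / 2)) ≠ 0) :
    cF q s k lm k lm x (-z) / cF q s k k lm lm z (-x) =
        cF q (s / 2) k lm 0 0 x (-(z / 2)) / cF q (s / 2) k 0 lm 0 (z / 2) (-x) ∧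
      (cF q s k lm k lm x z - cF q s k k lm lm z x) / cF q s k k lm lm z (-x) =
        (cF q (s / 2) k lm 0 0 x (z / 2) - cF q (s / 2) k 0 lm 0 (z / 2) x) /
          cF q (s / 2) k 0 lm 0 (z / 2) (-x) ∧
      cF q s k lm k lm x (-z) / cF q s k k lm lm z (-x) =
        qc q (-(4 * k * x) / s) * qc q (2 * (k + lm) * z / s) *
          (theta (qc q (2 * x)) (qc q s) * theta (qc q (s / 2 + 2 * lm + z)) (qc q s) *
            theta (qc q (2 * k + z)) (qc q s)) /
          (theta (qc q z) (qc q (s / 2)) * theta (qc q (k + lm + x)) (qc q (s / 2)) *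
            theta (-qc q (k - lm + x)) (qc q (s / 2))) := by
  obtain ⟨y, rfl⟩ : ∃ y, z = 2 * y := ⟨z / 2, by ring⟩
  have hs0 : (s : ℂ) ≠ 0 := mod_cast hs.ne'
  rw [show 2 * y / 2 = y by ring] at *
  rw [← mul_neg] at *
  obtain ⟨r, hr⟩ : ∃ r, r = qc q (s / 4) := ⟨_, rfl⟩
  obtain ⟨K, hK⟩ : ∃ K, K = qc q k := ⟨_, rfl⟩
  obtain ⟨L, hL⟩ : ∃ L, L = qc q lm := ⟨_, rfl⟩
  obtain ⟨X, hX⟩ : ∃ X, X = qc q x := ⟨_, rfl⟩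
  obtain ⟨Y, hY⟩ : ∃ Y, Y = qc q y := ⟨_, rfl⟩
  have hX' : X⁻¹ = qc q (-x) := by rw [qc_neg, hX]
  have hY' : Y⁻¹ = qc q (-y) := by rw [qc_neg, hY]
  have hr0 : r ≠ 0 := hr ▸ qc_ne_zero _ _
  have hK0 : K ≠ 0 := hK ▸ qc_ne_zero _ _
  have hL0 : L ≠ 0 := hL ▸ qc_ne_zero _ _
  have hX0 : X ≠ 0 := hX ▸ qc_ne_zero _ _
  have hY0 : Y ≠ 0 := hY ▸ qc_ne_zero _ _
  have hr1 : ‖r‖ < 1 := hr ▸ norm_qc_div_four_lt_one hq0 hq1 hs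
  have hh := norm_sq_lt_one hr1
  have hh0 : r ^ 2 ≠ 0 := pow_ne_zero 2 hr0
  have hp := norm_sq_lt_one hh
  have hp0 : (r ^ 2) ^ 2 ≠ 0 := pow_ne_zero 2 hh0
  obtain ⟨nJ1, eJ1⟩ := cF_eq_of_dual_params hq0 hq1 hs k lm x (-y) hr hK hL hX hY' hJ1
  obtain ⟨nJ2, eJ2⟩ := cF_eq_of_dual_params hq0 hq1 hs k lm x y hr hK hL hX hY hJ2
  obtain ⟨-, eJd1⟩ := cF_dual_eq_of_dual_params hq0 hq1 hs k lm x y hr hK hL hX hY hJd1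
  obtain ⟨nJd2, eJd2⟩ := cF_dual_eq_of_dual_params hq0 hq1 hs k lm (-x) y hr hK hL hX' hY hJd2
  obtain ⟨-, eR1⟩ := cF_eq_of_half_step hq0 hq1 hs k lm x (-y) hr hK hL hX hY' hR1
  obtain ⟨-, eR2⟩ := cF_eq_of_half_step hq0 hq1 hs k lm x y hr hK hL hX hY hR2
  obtain ⟨nRd1, eRd1⟩ := cF_dual_eq_of_half_step hq0 hq1 hs k lm x y hr hK hL hX hY hRd1
  obtain ⟨-, eRd2⟩ := cF_dual_eq_of_half_step hq0 hq1 hs k lm (-x) y hr hK hL hX' hY hRd2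
  -- the weights
  have w1 : Wgt q s k k lm (2 * y) x = Wgt q s k lm k x (2 * y) := by
    unfold Wgt; congr 1; ring
  have w2 : Wgt q (s / 2) k lm 0 x y = Wgt q s k lm k x (2 * y) := by
    unfold Wgt; congr 1; push_cast; field_simp; ring
  have w3 : Wgt q (s / 2) k 0 lm y x = Wgt q s k lm k x (2 * y) := by
    unfold Wgt; congr 1; push_cast; field_simp; ring
  have w4 : Wgt q (s / 2) k 0 lm y (-x) = Wgt q s k k lm (2 * y) (-x) := by
    unfold Wgt; congr 1; push_cast; field_simp; ring
  have w5 : Wgt q (s / 2) k lm 0 x (-y) = Wgt q s k lm k x (2 * -y) := by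
    unfold Wgt; congr 1; push_cast; field_simp; ring
  have w6 : qc q (-(4 * k * x) / s) * qc q (2 * (k + lm) * (2 * y) / s) =
      Wgt q s k k lm (2 * y) (-x) / Wgt q s k lm k x (2 * -y) := by
    simp only [Wgt, qc, ← Complex.exp_add, ← Complex.exp_sub]
    congr 1; field_simp; ring
  have hw : Wgt q s k lm k x (2 * y) ≠ 0 := qc_ne_zero _ _
  have hw' : Wgt q s k k lm (2 * y) (-x) ≠ 0 := qc_ne_zero _ _
  have hw'' : Wgt q s k lm k x (2 * -y) ≠ 0 := qc_ne_zero _ _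
  -- the arguments at `-x` and `-y`
  have a1 : -(r ^ 2 * X / (Y⁻¹ ^ 2 * K * L)) = -(r ^ 2 * Y ^ 2 * X / (K * L)) := by field_simp
  have a2 : K ^ 2 / Y⁻¹ ^ 2 = K ^ 2 * Y ^ 2 := by field_simp
  have a3 : r ^ 2 * L ^ 2 / Y⁻¹ ^ 2 = r ^ 2 * L ^ 2 * Y ^ 2 := by field_simp
  have a4 : (Y⁻¹ ^ 2)⁻¹ = Y ^ 2 := by field_simp
  have a5 : theta (-(r ^ 2 * Y⁻¹ ^ 2)) ((r ^ 2) ^ 2) = theta (-(r ^ 2 * Y ^ 2)) ((r ^ 2) ^ 2) := by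
    rw [← theta_nome_div hp0]; congr 1; field_simp
  have a6 : K * L / X⁻¹ = K * L * X := by field_simp
  have a7 : -(K / (L * X⁻¹)) = -(K * X / L) := by field_simp
  have a8 : -(r ^ 2 * Y ^ 2 / (X⁻¹ * K * L)) = -(r ^ 2 * Y ^ 2 * X / (K * L)) := by field_simp
  have a9 : (X⁻¹ ^ 2)⁻¹ = X ^ 2 := by field_simp
  have a10 : r * L / Y⁻¹ = r * L * Y := by field_simp
  have a11 : -(r * X / (Y⁻¹ * K)) = -(r * Y * X / K) := by field_simp
  have a12 : -(r * Y / (X⁻¹ * K)) = -(r * Y * X / K) := by field_simp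
  have a13 : theta (-(r * X⁻¹)) (r ^ 2) = theta (-(r * X)) (r ^ 2) := by
    rw [← theta_nome_div hh0]; congr 1; field_simp
  -- factorizations of theta functions
  have f1 : theta (r ^ 2 * L ^ 2 / Y ^ 2) ((r ^ 2) ^ 2) =
      theta (r * L / Y) (r ^ 2) * theta (-(r * L / Y)) (r ^ 2) := by
    rw [← theta_sq hh]; congr 1; ring
  have f2 : theta (r ^ 2 * L ^ 2 * Y ^ 2) ((r ^ 2) ^ 2) =
      theta (r * L * Y) (r ^ 2) * theta (-(r * L * Y)) (r ^ 2) := by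
    rw [← theta_sq hh]; congr 1; ring
  have f3 : theta (-(K / (L * X))) (r ^ 2) =
      theta (-(K / (L * X))) ((r ^ 2) ^ 2) * theta (-(r ^ 2 * K / (L * X))) ((r ^ 2) ^ 2) := by
    rw [theta_eq_mul_sq hh hh0 (by simp [hK0, hL0, hX0])]; congr 2; ring
  have f4 : theta (-(K * X / L)) (r ^ 2) =
      theta (-(K * X / L)) ((r ^ 2) ^ 2) * theta (-(r ^ 2 * K * X / L)) ((r ^ 2) ^ 2) := by
    rw [theta_eq_mul_sq hh hh0 (by simp [hK0, hL0, hX0])]; congr 2; ring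
  have f5 : theta (X ^ 2)⁻¹ ((r ^ 2) ^ 2) = -(X ^ 2)⁻¹ * theta (X ^ 2) ((r ^ 2) ^ 2) :=
    theta_inv hp (pow_ne_zero 2 hX0)
  -- the factors of the product formula
  have b1 : qc q (2 * x) = X ^ 2 := by
    rw [hX, qc, qc, ← Complex.exp_nat_mul]; congr 1; push_cast; ring
  have b2 : qc q (s / 2 + 2 * lm + 2 * y) = r ^ 2 * L ^ 2 * Y ^ 2 := by
    subst hr hL hY
    simp only [qc, ← Complex.exp_add, ← Complex.exp_nat_mul]
    congr 1; push_cast; ring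
  have b3 : qc q (2 * k + 2 * y) = K ^ 2 * Y ^ 2 := by
    subst hK hY
    simp only [qc, ← Complex.exp_add, ← Complex.exp_nat_mul]
    congr 1; push_cast; ring
  have b4 : qc q (2 * y) = Y ^ 2 := by
    rw [hY, qc, qc, ← Complex.exp_nat_mul]; congr 1; push_cast; ring
  have b5 : qc q (k + lm + x) = K * L * X := by
    subst hK hL hX
    simp only [qc, ← Complex.exp_add]
    congr 1; ring
  have b6 : qc q (k - lm + x) = K * X / L := by
    subst hK hL hX
    simp only [qc, ← Complex.exp_add, ← Complex.exp_sub]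
    congr 1; ring
  have b7 : qc q (s / 2) = r ^ 2 := hr ▸ qc_half_step q s
  have b8 : qc q s = (r ^ 2) ^ 2 := hr ▸ qc_step q s
  have hhalf := theta_quadratic_half hr1 hr0 hK0 hL0 hX0 hY0
  have hfull := theta_quadratic_full hr1 hr0 hK0 hL0 hX0 hY0
  rw [a4, a5] at nJ1
  rw [a1, a2, a3, a4, a5] at eJ1
  rw [a9] at nJd2
  rw [a6, a7, a8, a9] at eJd2
  rw [a2, a4, a10, a11, w5] at eR1
  rw [a6, a7, a9, a12, a13, f4, w4] at eRd2
  rw [f1] at eJ2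
  rw [w1] at eJd1
  rw [w2] at eR2
  rw [f3, w3] at eRd1
  rw [b4, b5, b6, b7] at hth
  rw [eJd2] at hc1
  rw [eRd2] at hc2
  rw [w6, b1, b2, b3, b4, b5, b6, b7, b8, eJ1, eJ2, eJd1, eJd2, eR1, eR2, eRd1, eRd2, f2, f4]
  simp only [ne_eq, div_eq_zero_iff, mul_eq_zero, not_or] at nJ1 nJ2 nJd2 nRd1 hth hc1 hc2
  obtain ⟨⟨hnY, hm⟩, ho⟩ := nJ1
  obtain ⟨⟨hn, -⟩, -⟩ := nJ2
  obtain ⟨hg, -⟩ := nJd2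
  obtain ⟨⟨-, hv⟩, hl⟩ := nRd1
  obtain ⟨⟨⟨hi, hj⟩, ht⟩, -⟩ := hc1
  obtain ⟨⟨-, hy⟩, -⟩ := hc2
  refine ⟨?_, div_sub_div_eq_of_quadratic hX0 hw hw' hn hm ho hg hv hl hi hj ht hy f5 hhalf hfull,
    ?_⟩
  all_goals
    generalize theta (Y ^ 2) (r ^ 2) = n at *
    generalize theta (-(r ^ 2 * Y ^ 2)) ((r ^ 2) ^ 2) = m at *
    generalize theta (-(r ^ 2 * K * X / L)) ((r ^ 2) ^ 2) = o at *
    generalize theta (X ^ 2) ((r ^ 2) ^ 2) = g at *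
    generalize theta (-(r * X)) (r ^ 2) = v at *
    generalize theta (-(r * L * Y)) (r ^ 2) = l at *
    generalize theta (K * L * X) (r ^ 2) = i at *
    generalize theta (-(K * X / L)) ((r ^ 2) ^ 2) = j at *
    generalize theta (-(r ^ 2 * Y ^ 2 * X / (K * L))) ((r ^ 2) ^ 2) = t at *
    generalize theta (-(r * Y * X / K)) (r ^ 2) = u at *
    field_simp

end
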